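/- Let X and Y be finite alphabets with |X| ≥ 2, let α ∈ (0,1), and let ε ∈ (0, 1 − 1/|X|]. If p and q are joint probability distributions on X × Y with TV(p,q) ≤ ε, then |H_α(X|Y)_p − H_α(X|Y)_q| ≤ (1/(1−α)) · log₂( (1−ε)^α + (|X|−1)^{1−α} · ε^α ). -/

import Mathlib

/-- Arimoto–Rényi conditional entropy of order `α` (base-2 logarithm),
for a joint distribution `p : X → Y → ℝ`. -/
noncomputable def condRenyi {X Y : Type*} [Fintype X] [Fintype Y]
    (α : ℝ) (p : X → Y → ℝ) : ℝ :=
  (α / (1 - α)) * Real.logb 2 (∑ y, (∑ x, p x y ^ α) ^ (1 / α))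

/-- Total variation distance between two joint distributions on `X × Y`. -/
noncomputable def TV {X Y : Type*} [Fintype X] [Fintype Y]
    (p q : X → Y → ℝ) : ℝ :=
  (1 / 2) * ∑ x, ∑ y, |p x y - q x y|

/-- The `ℓ^α` quasi-norm of a nonnegative family. -/
noncomputable def quasiNorm {ι : Type*} [Fintype ι] (α : ℝ) (v : ι → ℝ) : ℝ :=
  (∑ i, v i ^ α) ^ (1 / α)

section QuasiNorm

variable {ι : Type*} [Fintype ι] {α : ℝ}

/-- Weighted power mean inequality for an exponent in `(0, 1)`. -/
theorem rpow_sum_mul_rpow_le (h0 : 0 < α) (h1 : α < 1) (w x : ι → ℝ)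
    (hw : ∀ i, 0 ≤ w i) (hx : ∀ i, 0 ≤ x i) :
    (∑ i, w i * x i ^ α) ^ (1 / α) ≤ (∑ i, w i) ^ ((1 - α) / α) * ∑ i, w i * x i := by
  have hW : 0 ≤ ∑ i, w i := Finset.sum_nonneg fun i _ => hw i
  have hS : 0 ≤ ∑ i, w i * x i := Finset.sum_nonneg fun i _ => mul_nonneg (hw i) (hx i)
  have hN : 0 ≤ ∑ i, w i * x i ^ α :=
    Finset.sum_nonneg fun i _ => mul_nonneg (hw i) (Real.rpow_nonneg (hx i) _)
  have h := Real.inner_le_weight_mul_Lp_of_nonneg Finset.univ (p := α⁻¹)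
    ((one_le_inv₀ h0).2 h1.le) w (fun i => x i ^ α) hw (fun i => Real.rpow_nonneg (hx i) _)
  simp only [inv_inv, Real.rpow_rpow_inv (hx _) h0.ne'] at h
  calc _ ≤ ((∑ i, w i) ^ (1 - α) * (∑ i, w i * x i) ^ α) ^ (1 / α) :=
        Real.rpow_le_rpow hN h (by positivity)
    _ = _ := by
        rw [Real.mul_rpow (Real.rpow_nonneg hW _) (Real.rpow_nonneg hS _), ← Real.rpow_mul hW,
          one_div, Real.rpow_rpow_inv hS h0.ne', div_eq_mul_inv]

theorem sum_rpow_nonneg {v : ι → ℝ} (hv : ∀ i, 0 ≤ v i) : 0 ≤ ∑ i, v i ^ α :=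
  Finset.sum_nonneg fun i _ => Real.rpow_nonneg (hv i) _

theorem quasiNorm_nonneg {v : ι → ℝ} (hv : ∀ i, 0 ≤ v i) : 0 ≤ quasiNorm α v :=
  Real.rpow_nonneg (sum_rpow_nonneg hv) _

theorem quasiNorm_rpow (h0 : 0 < α) {v : ι → ℝ} (hv : ∀ i, 0 ≤ v i) :
    quasiNorm α v ^ α = ∑ i, v i ^ α := by
  rw [quasiNorm, one_div, Real.rpow_inv_rpow (sum_rpow_nonneg hv) h0.ne']

theorem sum_le_quasiNorm (h0 : 0 < α) (h1 : α < 1) {v : ι → ℝ} (hv : ∀ i, 0 ≤ v i) :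
    ∑ i, v i ≤ quasiNorm α v := by
  have hS := quasiNorm_nonneg (α := α) hv
  have hle : ∀ i, v i ≤ quasiNorm α v := fun i => by
    rw [← Real.rpow_le_rpow_iff (hv i) hS h0, quasiNorm_rpow h0 hv]
    exact Finset.single_le_sum (f := fun i => v i ^ α)
      (fun j _ => Real.rpow_nonneg (hv j) _) (Finset.mem_univ i)
  have split : ∀ t : ℝ, 0 ≤ t → t = t ^ α * t ^ (1 - α) := fun t ht => by
    rw [← Real.rpow_add' ht (by simp), add_sub_cancel, Real.rpow_one]
  calc ∑ i, v i ≤ ∑ i, v i ^ α * quasiNorm α v ^ (1 - α) := by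
        refine Finset.sum_le_sum fun i _ => ?_
        conv_lhs => rw [split _ (hv i)]
        exact mul_le_mul_of_nonneg_left (Real.rpow_le_rpow (hv i) (hle i) (by linarith))
          (Real.rpow_nonneg (hv i) _)
    _ = quasiNorm α v := by
        rw [← Finset.sum_mul, ← quasiNorm_rpow h0 hv, ← split _ hS]

/-- Reverse Minkowski inequality. -/
theorem quasiNorm_add_le (h0 : 0 < α) (h1 : α < 1) {m r : ι → ℝ}
    (hm : ∀ i, 0 ≤ m i) (hr : ∀ i, 0 ≤ r i) :
    quasiNorm α m + quasiNorm α r ≤ quasiNorm α (fun i => m i + r i) := by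
  have hq : ∀ i, 0 ≤ m i + r i := fun i => add_nonneg (hm i) (hr i)
  set N := ∑ i, (m i + r i) ^ α with hN
  have hN0 : 0 ≤ N := sum_rpow_nonneg hq
  have key : ∀ u : ι → ℝ, (∀ i, 0 ≤ u i) → (∀ i, u i ≤ m i + r i) →
      quasiNorm α u ≤ N ^ ((1 - α) / α) * ∑ i, (m i + r i) ^ α * (u i / (m i + r i)) := by
    intro u hu hle
    have h := rpow_sum_mul_rpow_le h0 h1 (fun i => (m i + r i) ^ α)
      (fun i => u i / (m i + r i)) (fun i => Real.rpow_nonneg (hq i) _)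
      (fun i => div_nonneg (hu i) (hq i))
    refine le_trans (le_of_eq ?_) h
    unfold quasiNorm
    congr 1
    refine Finset.sum_congr rfl fun i _ => ?_
    rw [← Real.mul_rpow (hq i) (div_nonneg (hu i) (hq i))]
    rcases (hq i).eq_or_lt with h | h
    · rw [← h, le_antisymm (h ▸ hle i) (hu i)]; simp
    · rw [mul_div_cancel₀ _ h.ne']
  have e : ∑ i, (m i + r i) ^ α * (m i / (m i + r i))
      + ∑ i, (m i + r i) ^ α * (r i / (m i + r i)) = N := by
    rw [← Finset.sum_add_distrib]
    refine Finset.sum_congr rfl fun i _ => ?_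
    rw [← mul_add, ← add_div]
    rcases (hq i).eq_or_lt with h | h
    · rw [← h]; simp [h0.ne']
    · rw [div_self h.ne', mul_one]
  calc _ ≤ N ^ ((1 - α) / α) * N := by
        refine le_of_le_of_eq (add_le_add (key m hm fun i => le_add_of_nonneg_right (hr i))
          (key r hr fun i => le_add_of_nonneg_left (hm i))) ?_
        rw [← mul_add, e]
    _ = _ := by
        have h : (1 - α) / α + 1 = 1 / α := by field_simp; ring
        rw [quasiNorm, ← hN, ← h, Real.rpow_add_one' hN0 (by rw [h]; positivity)]

/-- Hölder bound after splitting each `p i ^ α` in proportions `θ i` and `1 - θ i`. -/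
theorem quasiNorm_le_of_split (h0 : 0 < α) (h1 : α < 1) {a e : ℝ} (ha : 0 < a) (he : 0 < e)
    {p θ : ι → ℝ} (hp : ∀ i, 0 ≤ p i) (hθ0 : ∀ i, 0 ≤ θ i) (hθ1 : ∀ i, θ i ≤ 1)
    (hθ : 1 ≤ ∑ i, θ i) :
    quasiNorm α p ≤ (a ^ α + (Fintype.card ι - 1) * e ^ α) ^ ((1 - α) / α) *
      (a ^ (α - 1) * (∑ i, θ i * p i ^ α) ^ (1 / α)
        + e ^ (α - 1) * ∑ i, (1 - θ i) * p i) := by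
  have hT : 0 ≤ ∑ i, θ i * p i ^ α :=
    Finset.sum_nonneg fun i _ => mul_nonneg (hθ0 i) (Real.rpow_nonneg (hp i) _)
  set φ := (∑ i, θ i * p i ^ α) ^ (1 / α) with hφ
  have hφ0 : 0 ≤ φ := Real.rpow_nonneg hT _
  have h := rpow_sum_mul_rpow_le h0 h1
    (fun o : Option ι => o.elim (a ^ α) fun i => (1 - θ i) * e ^ α)
    (fun o : Option ι => o.elim (φ / a) fun i => p i / e)
    (by
      rintro (_ | i)
      · exact Real.rpow_nonneg ha.le _
      · exact mul_nonneg (sub_nonneg.2 (hθ1 i)) (Real.rpow_nonneg he.le _))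
    (by
      rintro (_ | i)
      · exact div_nonneg hφ0 ha.le
      · exact div_nonneg (hp i) he.le)
  simp only [Fintype.sum_option, Option.elim] at h
  have pw : ∀ t : ℝ, 0 < t → ∀ s : ℝ, t ^ α * (s / t) = t ^ (α - 1) * s := fun t ht s => by
    rw [Real.rpow_sub_one ht.ne']; ring
  have e1 : a ^ α * (φ / a) ^ α + ∑ i, (1 - θ i) * e ^ α * (p i / e) ^ α = ∑ i, p i ^ α := by
    rw [← Real.mul_rpow ha.le (div_nonneg hφ0 ha.le), mul_div_cancel₀ _ ha.ne', hφ, one_div,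
      Real.rpow_inv_rpow hT h0.ne', ← Finset.sum_add_distrib]
    refine Finset.sum_congr rfl fun i _ => ?_
    rw [mul_assoc, ← Real.mul_rpow he.le (div_nonneg (hp i) he.le), mul_div_cancel₀ _ he.ne']
    ring
  have e2 : a ^ α * (φ / a) + ∑ i, (1 - θ i) * e ^ α * (p i / e)
      = a ^ (α - 1) * φ + e ^ (α - 1) * ∑ i, (1 - θ i) * p i := by
    rw [pw a ha, Finset.mul_sum]
    congr 1
    refine Finset.sum_congr rfl fun i _ => ?_
    rw [mul_assoc, pw e he]
    ring
  rw [e1, e2] at h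
  have hs : ∑ i, (1 - θ i) * p i ≥ 0 :=
    Finset.sum_nonneg fun i _ => mul_nonneg (sub_nonneg.2 (hθ1 i)) (hp i)
  refine h.trans (mul_le_mul_of_nonneg_right (Real.rpow_le_rpow ?_ ?_ ?_) ?_)
  · exact add_nonneg (by positivity) (Finset.sum_nonneg fun i _ =>
      mul_nonneg (sub_nonneg.2 (hθ1 i)) (by positivity))
  · rw [← Finset.sum_mul, Finset.sum_sub_distrib]
    simp only [Finset.sum_const, Finset.card_univ, nsmul_eq_mul, mul_one]
    gcongr
  · exact div_nonneg (by linarith) h0.le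
  · positivity

/-- Comparison of the quasi-norms of two nonnegative families, linear in their common mass. -/
theorem quasiNorm_le_add_common_mass (h0 : 0 < α) (h1 : α < 1) {a e G H f : ℝ}
    (ha : 0 < a) (he : 0 < e)
    (hG : G = (a ^ α + (Fintype.card ι - 1) * e ^ α) ^ ((1 - α) / α) * a ^ (α - 1))
    (hH : H = (a ^ α + (Fintype.card ι - 1) * e ^ α) ^ ((1 - α) / α) * e ^ (α - 1))
    (hcard : 1 ≤ Fintype.card ι) (hGH : G ≤ H) (hGf : G ≤ f)
    {p q : ι → ℝ} (hp : ∀ i, 0 ≤ p i) (hq : ∀ i, 0 ≤ q i) :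
    quasiNorm α p ≤ f * (quasiNorm α q - ∑ i, q i) + G * (∑ i, min (p i) (q i))
      + H * (∑ i, p i - ∑ i, min (p i) (q i)) := by
  have hcard' : (1 : ℝ) ≤ Fintype.card ι := by exact_mod_cast hcard
  have hG0 : 0 ≤ G := by
    have : 0 ≤ (Fintype.card ι - 1 : ℝ) := by linarith
    rw [hG]; positivity
  have bound : ∀ θ : ι → ℝ, (∀ i, 0 ≤ θ i) → (∀ i, θ i ≤ 1) → 1 ≤ ∑ i, θ i →
      quasiNorm α p ≤ G * (∑ i, θ i * p i ^ α) ^ (1 / α)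
        + H * (∑ i, p i - ∑ i, θ i * p i) := fun θ hθ0 hθ1 hθ => by
    refine (quasiNorm_le_of_split h0 h1 ha he hp hθ0 hθ1 hθ).trans (le_of_eq ?_)
    rw [hG, hH]
    simp only [sub_mul, one_mul, Finset.sum_sub_distrib]
    ring
  have hm : ∀ i, 0 ≤ min (p i) (q i) := fun i => le_min (hp i) (hq i)
  set θ : ι → ℝ := fun i => min (p i) (q i) / p i
  have hθ0 : ∀ i, 0 ≤ θ i := fun i => div_nonneg (hm i) (hp i)
  have hθ1 : ∀ i, θ i ≤ 1 := fun i => div_le_one_of_le₀ (min_le_left _ _) (hp i)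
  have hθp : ∀ i, θ i * p i = min (p i) (q i) := fun i => by
    rcases (hp i).eq_or_lt with h | h
    · rw [← h, min_eq_left (hq i), mul_zero]
    · exact div_mul_cancel₀ _ h.ne'
  have hqs := sum_le_quasiNorm h0 h1 hq
  rcases le_or_gt 1 (∑ i, θ i) with hθ | hθ
  · have b := bound θ hθ0 hθ1 hθ
    simp only [hθp] at b
    have hφ : (∑ i, θ i * p i ^ α) ^ (1 / α) ≤ quasiNorm α fun i => min (p i) (q i) := by
      refine Real.rpow_le_rpow (Finset.sum_nonneg fun i _ =>
        mul_nonneg (hθ0 i) (Real.rpow_nonneg (hp i) _)) (Finset.sum_le_sum fun i _ => ?_)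
        (by positivity)
      beta_reduce
      rw [← hθp, Real.mul_rpow (hθ0 i) (hp i)]
      refine mul_le_mul_of_nonneg_right ?_ (Real.rpow_nonneg (hp i) _)
      exact Real.self_le_rpow_of_le_one (hθ0 i) (hθ1 i) h1.le
    have hr : ∀ i, 0 ≤ q i - min (p i) (q i) := fun i => sub_nonneg.2 (min_le_right _ _)
    have hadd := quasiNorm_add_le h0 h1 hm hr
    simp only [add_sub_cancel] at hadd
    have hrs := sum_le_quasiNorm h0 h1 hr
    rw [Finset.sum_sub_distrib] at hrs
    have k1 := mul_le_mul_of_nonneg_left (show (∑ i, θ i * p i ^ α) ^ (1 / α)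
      - ∑ i, min (p i) (q i) ≤ quasiNorm α q - ∑ i, q i by linarith) hG0
    have k2 := mul_le_mul_of_nonneg_right hGf (sub_nonneg.2 hqs)
    linarith
  · set c := (1 - ∑ i, θ i) / Fintype.card ι with hc
    have hc0 : 0 ≤ c := div_nonneg (by linarith) (by linarith)
    have hc1 : c ≤ 1 - ∑ i, θ i := div_le_self (by linarith) hcard'
    have hsum : ∑ i, (θ i + c) = 1 := by
      rw [Finset.sum_add_distrib]
      simp only [Finset.sum_const, Finset.card_univ, nsmul_eq_mul]
      rw [hc, mul_div_cancel₀ _ (by linarith)]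
      ring
    have hθc0 : ∀ i, 0 ≤ θ i + c := fun i => add_nonneg (hθ0 i) hc0
    have b := bound (fun i => θ i + c) hθc0 (fun i => by
      have := Finset.single_le_sum (fun j _ => hθ0 j) (Finset.mem_univ i)
      linarith) hsum.ge
    have hpm := rpow_sum_mul_rpow_le h0 h1 (fun i => θ i + c) p hθc0 hp
    rw [hsum, Real.one_rpow, one_mul] at hpm
    have hM : ∑ i, min (p i) (q i) ≤ ∑ i, (θ i + c) * p i :=
      Finset.sum_le_sum fun i _ => by
        rw [← hθp]
        exact mul_le_mul_of_nonneg_right (by linarith) (hp i)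
    have k1 := mul_le_mul_of_nonneg_left hpm hG0
    have k2 := mul_nonneg (sub_nonneg.2 hGH) (sub_nonneg.2 hM)
    have k3 := mul_nonneg (hG0.trans hGf) (sub_nonneg.2 hqs)
    linarith

end QuasiNorm

theorem card_mul_rpow_eq {d ε α : ℝ} (hd : 0 < d) (hε : 0 < ε) :
    d * (ε / d) ^ α = d ^ (1 - α) * ε ^ α := by
  rw [Real.div_rpow hε.le hd.le, Real.rpow_sub hd, Real.rpow_one]
  ring

/-- Multiplicative continuity of the mean quasi-norm of joint distributions. -/
theorem sum_quasiNorm_le_mul {X Y : Type*} [Fintype X] [Fintype Y]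
    (hX : 2 ≤ Fintype.card X)
    (α ε : ℝ) (hα : α ∈ Set.Ioo (0 : ℝ) 1)
    (hε : ε ∈ Set.Ioc (0 : ℝ) (1 - 1 / (Fintype.card X : ℝ)))
    (p q : X → Y → ℝ)
    (hp0 : ∀ x y, 0 ≤ p x y) (hp1 : (∑ x, ∑ y, p x y) = 1)
    (hq0 : ∀ x y, 0 ≤ q x y) (hq1 : (∑ x, ∑ y, q x y) = 1)
    (hTV : TV p q ≤ ε) :
    ∑ y, quasiNorm α (fun x => p x y) ≤
      ((1 - ε) ^ α + ((Fintype.card X : ℝ) - 1) ^ (1 - α) * ε ^ α) ^ (1 / α) *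
        ∑ y, quasiNorm α (fun x => q x y) := by
  obtain ⟨h0, h1⟩ := hα
  obtain ⟨hε0, hε1⟩ := hε
  have hX' : (2 : ℝ) ≤ Fintype.card X := by exact_mod_cast hX
  set d := (Fintype.card X : ℝ)
  have hd1 : 0 < d - 1 := by linarith
  have hεd : ε * d ≤ d - 1 := by
    have := mul_le_mul_of_nonneg_right hε1 (by linarith : 0 ≤ d)
    rwa [sub_mul, one_mul, one_div, inv_mul_cancel₀ (by linarith)] at this
  have ha : 0 < 1 - ε := by nlinarith
  have he : 0 < ε / (d - 1) := div_pos hε0 hd1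
  have hea : ε / (d - 1) ≤ 1 - ε := by rw [div_le_iff₀ hd1]; nlinarith
  set a := 1 - ε with hadef
  set e := ε / (d - 1) with hedef
  rw [← card_mul_rpow_eq hd1 hε0, ← hedef]
  set B := a ^ α + (d - 1) * e ^ α with hB
  have hB0 : 0 < B := by positivity
  have hpow : ∀ t : ℝ, 0 < t → t ^ α = t * t ^ (α - 1) := fun t ht => by
    rw [Real.rpow_sub_one ht.ne', mul_div_cancel₀ _ ht.ne']
  have hanti : a ^ (α - 1) ≤ e ^ (α - 1) :=
    Real.rpow_le_rpow_of_nonpos he hea (by linarith)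
  have hBeq : B = a * a ^ (α - 1) + ε * e ^ (α - 1) := by
    rw [hB, hpow a ha, hpow e he, ← mul_assoc, hedef, mul_div_cancel₀ _ hd1.ne']
  have haB : a ^ (α - 1) ≤ B := by
    have := mul_le_mul_of_nonneg_left hanti hε0.le
    have : a * a ^ (α - 1) = a ^ (α - 1) - ε * a ^ (α - 1) := by rw [hadef]; ring
    linarith
  set K := B ^ ((1 - α) / α) with hK
  have hK0 : 0 < K := Real.rpow_pos_of_pos hB0 _
  have hf : B ^ (1 / α) = K * B := by
    rw [hK, ← Real.rpow_add_one hB0.ne']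
    congr 1
    field_simp
    ring
  set f := B ^ (1 / α)
  have hGH := mul_le_mul_of_nonneg_left hanti hK0.le
  have hGf := mul_le_mul_of_nonneg_left haB hK0.le
  rw [← hf] at hGf
  have hsum := Finset.sum_le_sum fun y (_ : y ∈ Finset.univ) =>
    quasiNorm_le_add_common_mass h0 h1 ha he rfl rfl (by omega) hGH hGf
      (fun x => hp0 x y) (fun x => hq0 x y)
  simp only [Finset.sum_add_distrib, ← Finset.mul_sum, Finset.sum_sub_distrib] at hsum
  rw [Finset.sum_comm] at hp1 hq1
  rw [hp1, hq1] at hsum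
  set M := ∑ y, ∑ x, min (p x y) (q x y) with hM
  have hMε : 1 - M ≤ ε := by
    have : TV p q = 1 - M := by
      have hmin : ∀ x y, min (p x y) (q x y) = (p x y + q x y - |p x y - q x y|) / 2 :=
        fun x y => by linarith [max_sub_min_eq_abs' (p x y) (q x y), max_add_min (p x y) (q x y)]
      rw [hM, TV, Finset.sum_comm]
      simp only [hmin, ← Finset.sum_div, Finset.sum_sub_distrib, Finset.sum_add_distrib]
      rw [hp1, hq1]
      ring
    linarith
  have hlast : K * a ^ (α - 1) * M + K * e ^ (α - 1) * (1 - M) ≤ f := by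
    have : f = K * a ^ (α - 1) * (1 - ε) + K * e ^ (α - 1) * ε := by
      rw [hf, hBeq, ← hadef]; ring
    nlinarith [mul_nonneg (sub_nonneg.2 hGH) (sub_nonneg.2 hMε)]
  linarith

theorem condRenyi_sub_le {X Y : Type*} [Fintype X] [Fintype Y]
    (hX : 2 ≤ Fintype.card X)
    (α ε : ℝ) (hα : α ∈ Set.Ioo (0 : ℝ) 1)
    (hε : ε ∈ Set.Ioc (0 : ℝ) (1 - 1 / (Fintype.card X : ℝ)))
    (p q : X → Y → ℝ)
    (hp0 : ∀ x y, 0 ≤ p x y) (hp1 : (∑ x, ∑ y, p x y) = 1)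
    (hq0 : ∀ x y, 0 ≤ q x y) (hq1 : (∑ x, ∑ y, q x y) = 1)
    (hTV : TV p q ≤ ε) :
    condRenyi α p - condRenyi α q ≤
      (1 / (1 - α)) *
        Real.logb 2 ((1 - ε) ^ α + ((Fintype.card X : ℝ) - 1) ^ (1 - α) * ε ^ α) := by
  have key := sum_quasiNorm_le_mul hX α ε hα hε p q hp0 hp1 hq0 hq1 hTV
  obtain ⟨h0, h1⟩ := hα
  have pos : ∀ r : X → Y → ℝ, (∀ x y, 0 ≤ r x y) → (∑ x, ∑ y, r x y) = 1 →
      0 < ∑ y, quasiNorm α (fun x => r x y) := fun r hr0 hr1 => by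
    have := Finset.sum_le_sum fun y (_ : y ∈ Finset.univ) =>
      sum_le_quasiNorm h0 h1 (fun x => hr0 x y)
    rw [Finset.sum_comm, hr1] at this
    linarith
  have hP := pos p hp0 hp1
  have hQ := pos q hq0 hq1
  have hX' : (2 : ℝ) ≤ Fintype.card X := by exact_mod_cast hX
  have hB : 0 < (1 - ε) ^ α + ((Fintype.card X : ℝ) - 1) ^ (1 - α) * ε ^ α := by
    have : 0 < 1 / (Fintype.card X : ℝ) := by positivity
    have : 0 < 1 - ε := by linarith [hε.2]
    have : 0 < (Fintype.card X : ℝ) - 1 := by linarith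
    have := hε.1
    positivity
  set B := (1 - ε) ^ α + ((Fintype.card X : ℝ) - 1) ^ (1 - α) * ε ^ α
  have hlog := Real.logb_le_logb_of_le one_lt_two hP key
  rw [Real.logb_mul (Real.rpow_pos_of_pos hB _).ne' hQ.ne',
    Real.logb_rpow_eq_mul_logb_of_pos hB] at hlog
  have hc : 0 ≤ α / (1 - α) := div_nonneg h0.le (by linarith)
  calc condRenyi α p - condRenyi α q
      = α / (1 - α) * (Real.logb 2 (∑ y, quasiNorm α (fun x => p x y))
        - Real.logb 2 (∑ y, quasiNorm α (fun x => q x y))) := by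
        simp only [condRenyi, quasiNorm]; ring
    _ ≤ α / (1 - α) * (1 / α * Real.logb 2 B) :=
        mul_le_mul_of_nonneg_left (by linarith) hc
    _ = _ := by
        have : 1 - α ≠ 0 := by linarith
        field_simp

theorem arce_uniform_continuity_bound
    {X Y : Type*} [Fintype X] [Fintype Y]
    (hX : 2 ≤ Fintype.card X)
    (α ε : ℝ) (hα : α ∈ Set.Ioo (0 : ℝ) 1)
    (hε : ε ∈ Set.Ioc (0 : ℝ) (1 - 1 / (Fintype.card X : ℝ)))
    (p q : X → Y → ℝ)
    (hp0 : ∀ x y, 0 ≤ p x y) (hp1 : (∑ x, ∑ y, p x y) = 1)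
    (hq0 : ∀ x y, 0 ≤ q x y) (hq1 : (∑ x, ∑ y, q x y) = 1)
    (hTV : TV p q ≤ ε) :
    |condRenyi α p - condRenyi α q| ≤
      (1 / (1 - α)) *
        Real.logb 2 ((1 - ε) ^ α + ((Fintype.card X : ℝ) - 1) ^ (1 - α) * ε ^ α) := by
  have hTV' : TV q p ≤ ε := by
    simpa only [TV, abs_sub_comm] using hTV
  refine abs_sub_le_iff.2 ⟨?_, ?_⟩
  · exact condRenyi_sub_le hX α ε hα hε p q hp0 hp1 hq0 hq1 hTV
  · exact condRenyi_sub_le hX α ε hα hε q p hq0 hq1 hp0 hp1 hTV'
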